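/- Let G be a connected finite weighted graph with positive edge weights, and let u and v be two vertices of G satisfying: (1) the shortest u-v path P = (u = v_0, v_1, ..., v_k = v) in G is unique; (2) for every vertex x of G there is a unique vertex v_i on P with d_G(x, v_i) = d_G(x, V(P)); and (3) with V_i = {x ∈ V(G) : d_G(x, v_i) = d_G(x, V(P))}, whenever e = xy is an edge of G with x ∈ V_i and y ∈ V_j, one has w(e) ≥ d_G(v_i, v_j) and |d_G(v_i, x) − d_G(v_j, y)| ≤ w(e) − d_G(v_i, v_j). Define W : V(G) → ℝ by W(x) = d_G(u, v_i) + d_G(v_i, x) where v_i is the unique vertex of P with x ∈ V_i. Then for every edge e = xy of G, |W(x) − W(y)| ≤ w(e). -/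

import Mathlib

open SimpleGraph

/-- The weighted length of a walk: the sum of the weights of its edges. -/
def SimpleGraph.Walk.wlength {V : Type*} {G : SimpleGraph V} (w : V → V → ℝ) {x y : V}
    (p : G.Walk x y) : ℝ :=
  (p.darts.map fun d => w d.toProd.1 d.toProd.2).sum

/-- The weighted distance between two vertices: the minimum weighted length of a walk. -/
noncomputable def SimpleGraph.wdist {V : Type*} (G : SimpleGraph V) (w : V → V → ℝ)
    (x y : V) : ℝ :=
  sInf {r : ℝ | ∃ p : G.Walk x y, p.wlength w = r}

/-- The weighted distance from a vertex to a set of vertices. -/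
noncomputable def SimpleGraph.wdistS {V : Type*} (G : SimpleGraph V) (w : V → V → ℝ)
    (x : V) (S : Set V) : ℝ :=
  sInf (G.wdist w x '' S)

/-- `Vset G w P i` is the set of vertices whose nearest vertex on the walk `P` is `P.getVert i`,
i.e. `V_i = {x : d_G(x, v_i) = d_G(x, V(P))}`. -/
def Vset {V : Type*} (G : SimpleGraph V) (w : V → V → ℝ) {u v : V} (P : G.Walk u v)
    (i : ℕ) : Set V :=
  {x : V | G.wdist w x (P.getVert i) = G.wdistS w x {z | z ∈ P.support}}

namespace SimpleGraph

variable {V : Type*} {G : SimpleGraph V} {w : V → V → ℝ}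

theorem Walk.wlength_append {x y z : V} (p : G.Walk x y) (q : G.Walk y z) :
    (p.append q).wlength w = p.wlength w + q.wlength w := by
  simp [Walk.wlength]

theorem Walk.wlength_reverse (hsymm : ∀ a b : V, w a b = w b a) {x y : V} (p : G.Walk x y) :
    p.reverse.wlength w = p.wlength w := by
  have h : ((fun d : G.Dart => w d.toProd.1 d.toProd.2) ∘ Dart.symm) =
      fun d : G.Dart => w d.toProd.1 d.toProd.2 := by
    funext d
    exact hsymm _ _
  simp only [Walk.wlength, Walk.darts_reverse, List.map_reverse, List.map_map, List.sum_reverse, h]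

theorem Walk.wlength_nonneg (hpos : ∀ a b : V, G.Adj a b → 0 < w a b) {x y : V}
    (p : G.Walk x y) : 0 ≤ p.wlength w := by
  refine List.sum_nonneg fun r hr => ?_
  obtain ⟨d, -, rfl⟩ := List.mem_map.1 hr
  exact (hpos _ _ d.adj).le

theorem wdist_comm (hsymm : ∀ a b : V, w a b = w b a) (x y : V) :
    G.wdist w x y = G.wdist w y x := by
  unfold wdist
  congr 1
  ext r
  constructor <;> rintro ⟨p, rfl⟩ <;> exact ⟨p.reverse, p.wlength_reverse hsymm⟩

theorem wdist_le_wlength (hpos : ∀ a b : V, G.Adj a b → 0 < w a b) {x y : V}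
    (p : G.Walk x y) : G.wdist w x y ≤ p.wlength w :=
  csInf_le ⟨0, by rintro _ ⟨q, rfl⟩; exact q.wlength_nonneg hpos⟩ ⟨p, rfl⟩

theorem Connected.le_wdist (hG : G.Connected) {x y : V} {r : ℝ}
    (h : ∀ p : G.Walk x y, r ≤ p.wlength w) : r ≤ G.wdist w x y := by
  obtain ⟨p⟩ := hG.preconnected x y
  exact le_csInf ⟨_, p, rfl⟩ (by rintro _ ⟨q, rfl⟩; exact h q)

theorem Connected.wdist_triangle (hG : G.Connected) (hpos : ∀ a b : V, G.Adj a b → 0 < w a b)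
    (x y z : V) : G.wdist w x z ≤ G.wdist w x y + G.wdist w y z := by
  rw [← sub_le_iff_le_add]
  refine hG.le_wdist fun p => ?_
  rw [sub_le_comm]
  refine hG.le_wdist fun q => ?_
  rw [sub_le_iff_le_add', ← Walk.wlength_append]
  exact wdist_le_wlength hpos _

end SimpleGraph

/-- Under conditions (1), (2) and (3), the potential `W(x) = d_G(u, v_i) + d_G(v_i, x)`
(where `v_i` is the unique vertex of `P` with `x ∈ V_i`) changes by at most `w(e)` along
any edge `e = xy` of `G`. -/
theorem potential_lipschitz {V : Type*} [Fintype V] (G : SimpleGraph V)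
    (hG : G.Connected) (w : V → V → ℝ) (hsymm : ∀ a b : V, w a b = w b a)
    (hpos : ∀ a b : V, G.Adj a b → 0 < w a b) (u v : V)
    (P : G.Walk u v) (hP : P.IsPath) (hPshort : P.wlength w = G.wdist w u v)
    (hPuniq : ∀ Q : G.Walk u v, Q.IsPath → Q.wlength w = G.wdist w u v → Q = P)
    (hnear : ∀ x : V, ∃! y : V, y ∈ P.support ∧
      G.wdist w x y = G.wdistS w x {z | z ∈ P.support})
    (hedge : ∀ i j : ℕ, i ≤ P.length → j ≤ P.length → ∀ x y : V, G.Adj x y →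
      x ∈ Vset G w P i → y ∈ Vset G w P j →
      w x y ≥ G.wdist w (P.getVert i) (P.getVert j) ∧
        |G.wdist w (P.getVert i) x - G.wdist w (P.getVert j) y| ≤
          w x y - G.wdist w (P.getVert i) (P.getVert j))
    (W : V → ℝ)
    (hW : ∀ (x : V) (i : ℕ), i ≤ P.length → x ∈ Vset G w P i →
      W x = G.wdist w u (P.getVert i) + G.wdist w (P.getVert i) x) :
    ∀ x y : V, G.Adj x y → |W x - W y| ≤ w x y := by
  intro x y hxy
  have key : ∀ z : V, ∃ i ≤ P.length, z ∈ Vset G w P i := fun z => by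
    obtain ⟨a, ⟨ha, hd⟩, -⟩ := hnear z
    obtain ⟨i, rfl, hi⟩ := Walk.mem_support_iff_exists_getVert.1 ha
    exact ⟨i, hi, hd⟩
  obtain ⟨i, hi, hxi⟩ := key x
  obtain ⟨j, hj, hyj⟩ := key y
  have he := abs_le.1 (hedge i j hi hj x y hxy hxi hyj).2
  have h₁ := hG.wdist_triangle hpos u (P.getVert i) (P.getVert j)
  have h₂ := hG.wdist_triangle hpos u (P.getVert j) (P.getVert i)
  rw [wdist_comm hsymm (P.getVert j)] at h₂
  rw [hW x i hi hxi, hW y j hj hyj, abs_le]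
  constructor <;> linarith [he.1, he.2]
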